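/- Let k, m be fixed natural numbers and let α be a fixed real number with 0 ≤ α < 1. Suppose that for every ε > 0 one has ∫_T^{2T} J_k(t,G)^m dt ≪_ε T^{1+ε} uniformly for all G with T^{α+ε} ≤ G ≤ T. Then for every ε > 0 one has ∫_0^T |ζ(1/2 + it)|^{2km} dt ≪_ε T^{1+(m-1)α+ε}. -/

import Mathlib

open Real MeasureTheory

/-- The smoothed moment `J_k(t,G) = (1/(√π G)) ∫_ℝ |ζ(1/2+it+iu)|^{2k} e^{-(u/G)²} du`. -/
noncomputable def J (k : ℕ) (t G : ℝ) : ℝ :=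
  (1 / (Real.sqrt Real.pi * G)) *
    ∫ u : ℝ, ‖riemannZeta (1 / 2 + Complex.I * (t : ℂ) + Complex.I * (u : ℂ))‖ ^ (2 * k) *
      Real.exp (-(u / G) ^ 2)

noncomputable def zb (n : ℕ) (s : ℂ) : ℂ :=
  (s - 1) * ((n + 2 : ℝ) : ℂ) ^ (-s) + ((n + 2 : ℝ) : ℂ) ^ (1 - s) - ((n + 1 : ℝ) : ℂ) ^ (1 - s)

lemma zb_deriv (x : ℝ) (hx : 0 < x) (s : ℂ) :
    HasDerivAt (fun y : ℝ => (y : ℂ) ^ s) (s * (x : ℂ) ^ (s - 1)) x := by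
  by_cases hs : s = 0
  · subst hs
    simpa using hasDerivAt_const x (1 : ℂ)
  · exact hasDerivAt_ofReal_cpow_const hx.ne' hs

lemma zb_bound (n : ℕ) (s : ℂ) (hs : 0 ≤ s.re) :
    ‖zb n s‖ ≤ ‖s - 1‖ * ‖s‖ * ((n : ℝ) + 1) ^ (-s.re - 1) := by
  have h1 : ∀ x ∈ Set.Icc ((n : ℝ) + 1) (n + 2),
      ‖((n + 2 : ℝ) : ℂ) ^ (-s) - (x : ℂ) ^ (-s)‖ ≤ ‖s‖ * ((n : ℝ) + 1) ^ (-s.re - 1) := by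
    intro x hx
    have hn : (0 : ℝ) ≤ n := Nat.cast_nonneg n
    have := (convex_Icc ((n : ℝ) + 1) (n + 2)).norm_image_sub_le_of_norm_hasDerivWithin_le
      (f := fun y : ℝ => (y : ℂ) ^ (-s)) (f' := fun y : ℝ => (-s) * (y : ℂ) ^ (-s - 1))
      (C := ‖s‖ * ((n : ℝ) + 1) ^ (-s.re - 1)) (x := x) (y := n + 2)
      (fun y hy => (zb_deriv y (by linarith [hy.1]) (-s)).hasDerivWithinAt)
      (fun y hy => by
        have hy0 : 0 < y := by linarith [hy.1]
        rw [norm_mul, norm_neg, Complex.norm_cpow_eq_rpow_re_of_pos hy0]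
        have : (-s - 1).re = -s.re - 1 := by simp
        rw [this]
        gcongr ?_ * ?_
        exact Real.rpow_le_rpow_of_nonpos (by linarith) hy.1 (by linarith))
      hx ⟨by linarith, le_refl _⟩
    refine this.trans ?_
    have h3 : ‖(n : ℝ) + 2 - x‖ ≤ 1 := by
      rw [Real.norm_eq_abs, abs_le]; constructor <;> linarith [hx.1, hx.2]
    have h4 : 0 ≤ ‖s‖ * ((n : ℝ) + 1) ^ (-s.re - 1) := by positivity
    nlinarith
  have hn : (0 : ℝ) ≤ n := Nat.cast_nonneg n
  have := (convex_Icc ((n : ℝ) + 1) (n + 2)).norm_image_sub_le_of_norm_hasDerivWithin_le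
      (f := fun y : ℝ => (y : ℂ) ^ (1 - s) + (y : ℂ) * ((s - 1) * ((n + 2 : ℝ) : ℂ) ^ (-s)))
      (f' := fun y : ℝ => (1 - s) * (y : ℂ) ^ (1 - s - 1) + 1 * ((s - 1) * ((n + 2 : ℝ) : ℂ) ^ (-s)))
      (C := ‖s - 1‖ * ‖s‖ * ((n : ℝ) + 1) ^ (-s.re - 1)) (x := n + 1) (y := n + 2)
      (fun y hy => ((zb_deriv y (by linarith [hy.1]) (1 - s)).add
        ((Complex.ofRealCLM.hasDerivAt).mul_const _)).hasDerivWithinAt)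
      (fun y hy => by
        have e : (1 - s) * (y : ℂ) ^ (1 - s - 1) + 1 * ((s - 1) * ((n + 2 : ℝ) : ℂ) ^ (-s))
          = (s - 1) * (((n + 2 : ℝ) : ℂ) ^ (-s) - (y : ℂ) ^ (-s)) := by
          have : 1 - s - 1 = -s := by ring
          rw [this]; ring
        rw [e, norm_mul, mul_assoc]
        gcongr
        exact h1 y hy)
      ⟨le_refl _, by linarith⟩ ⟨by linarith, le_refl _⟩
  have h5 : ‖(n : ℝ) + 2 - (n + 1)‖ = 1 := by norm_num
  rw [h5, mul_one] at this
  have e : zb n s = (((n : ℝ) + 2 : ℝ) : ℂ) ^ (1 - s) + (((n : ℝ) + 2 : ℝ) : ℂ) * ((s - 1) * ((n + 2 : ℝ) : ℂ) ^ (-s)) - ((((n : ℝ) + 1 : ℝ) : ℂ) ^ (1 - s) + (((n : ℝ) + 1 : ℝ) : ℂ) * ((s - 1) * ((n + 2 : ℝ) : ℂ) ^ (-s))) := by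
    unfold zb
    push_cast
    ring
  rw [e]
  exact this

lemma zb_partial (s : ℂ) (M : ℕ) : s + ∑ n ∈ Finset.range M, zb n s =
    (s - 1) * ∑ n ∈ Finset.range (M + 1), ((n + 1 : ℝ) : ℂ) ^ (-s) + ((M + 1 : ℝ) : ℂ) ^ (1 - s) := by
  induction M with
  | zero => simp
  | succ M ih =>
    rw [Finset.sum_range_succ, ← add_assoc, ih, Finset.sum_range_succ _ (M + 1)]
    unfold zb
    push_cast
    ring_nf

lemma zb_summable (s : ℂ) (hs : 0 < s.re) : Summable (fun n => zb n s) := by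
  have h : Summable (fun n : ℕ => ((n : ℝ) + 1) ^ (-s.re - 1)) := by
    have := (summable_nat_add_iff 1).2 (Real.summable_nat_rpow (p := -s.re - 1)|>.2 (by linarith))
    simpa using this
  exact Summable.of_norm_bounded (h.mul_left (‖s - 1‖ * ‖s‖)) (fun n => zb_bound n s hs.le)

lemma zeta1_eq (s : ℂ) (hs : 0 < s.re) : riemannZeta₁ s = s + ∑' n, zb n s := by
  have hopen : IsOpen {s : ℂ | 0 < s.re} := isOpen_lt continuous_const Complex.continuous_re
  have hd : DifferentiableOn ℂ (fun s => s + ∑' n, zb n s) {s : ℂ | 0 < s.re} := by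
    intro s hs
    change 0 < s.re at hs
    set U : Set ℂ := {z | s.re / 2 < z.re} ∩ Metric.ball 0 (‖s‖ + 1)
    have hU : IsOpen U := (isOpen_lt continuous_const Complex.continuous_re).inter Metric.isOpen_ball
    have hsU : s ∈ U := ⟨by change s.re / 2 < s.re; linarith, by simp⟩
    have hsum : Summable (fun n : ℕ => ((‖s‖ + 1 + 1) * (‖s‖ + 1)) * ((n : ℝ) + 1) ^ (-(s.re / 2) - 1)) := by
      have := (summable_nat_add_iff 1).2 (Real.summable_nat_rpow (p := -(s.re/2) - 1)|>.2 (by linarith))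
      apply Summable.mul_left
      simpa using this
    have := Complex.differentiableOn_tsum_of_summable_norm (F := zb) (U := U) hsum
      (fun n => by
        intro z hz
        unfold zb
        have a1 : ((n + 2 : ℝ) : ℂ) ≠ 0 := by
          exact_mod_cast (by positivity : (0:ℝ) < n + 2).ne'
        have a2 : ((n + 1 : ℝ) : ℂ) ≠ 0 := by
          exact_mod_cast (by positivity : (0:ℝ) < n + 1).ne'
        apply DifferentiableAt.differentiableWithinAt
        refine DifferentiableAt.sub (DifferentiableAt.add (DifferentiableAt.mul (by fun_prop) ?_) ?_) ?_
        · exact DifferentiableAt.const_cpow (by fun_prop) (Or.inl a1)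
        · exact DifferentiableAt.const_cpow (by fun_prop) (Or.inl a1)
        · exact DifferentiableAt.const_cpow (by fun_prop) (Or.inl a2))
      hU
      (fun n w hw => by
        have w1 : s.re / 2 < w.re := hw.1
        have w2 : ‖w‖ < ‖s‖ + 1 := by simpa using hw.2
        refine (zb_bound n w (by linarith)).trans ?_
        have : ‖w - 1‖ ≤ ‖s‖ + 1 + 1 := (norm_sub_le _ _).trans (by simp; linarith)
        gcongr
        linarith)
    exact ((differentiableAt_id).add (this.differentiableAt (hU.mem_nhds hsU))).differentiableWithinAt
  have key := AnalyticOnNhd.eqOn_of_preconnected_of_eventuallyEq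
    (differentiable_riemannZeta₁.differentiableOn.analyticOnNhd hopen)
    (hd.analyticOnNhd hopen) (convex_halfSpace_re_gt 0).isPreconnected (z₀ := 2) (by simp) (by
      have : {s : ℂ | 1 < s.re} ∈ nhds (2 : ℂ) :=
        (isOpen_lt continuous_const Complex.continuous_re).mem_nhds (by simp)
      filter_upwards [this] with z hz
      change 1 < z.re at hz
      have hz1 : z ≠ 1 := by rintro rfl; simp at hz
      have e1 : riemannZeta₁ z = (z - 1) * riemannZeta z := by
        rw [riemannZeta_eq_inv_sub_mul hz1, mul_inv_cancel_left₀ (sub_ne_zero.2 hz1)]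
      have t1 := ((zb_summable z (by linarith)).hasSum.tendsto_sum_nat).const_add z
      have hs1 : Summable (fun n : ℕ => ((n + 1 : ℝ) : ℂ) ^ (-z)) := by
        have := (summable_nat_add_iff 1).2 (Complex.summable_one_div_nat_cpow.2 hz)
        have e : (fun n : ℕ => ((n + 1 : ℝ) : ℂ) ^ (-z)) = fun n : ℕ => 1 / ((n + 1 : ℕ) : ℂ) ^ z := by
          funext n
          push_cast
          rw [Complex.cpow_neg, one_div]
        rw [e]
        exact this
      have e2 : riemannZeta z = ∑' n : ℕ, ((n + 1 : ℝ) : ℂ) ^ (-z) := by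
        rw [zeta_eq_tsum_one_div_nat_add_one_cpow hz]
        congr 1; ext n
        push_cast
        rw [Complex.cpow_neg, one_div]
      have t2 := (((Filter.tendsto_add_atTop_iff_nat 1).2 hs1.hasSum.tendsto_sum_nat).const_mul (z - 1))
      have t3 : Filter.Tendsto (fun M : ℕ => ((M + 1 : ℝ) : ℂ) ^ (1 - z)) Filter.atTop (nhds 0) := by
        rw [tendsto_zero_iff_norm_tendsto_zero]
        have : ∀ M : ℕ, ‖((M + 1 : ℝ) : ℂ) ^ (1 - z)‖ = ((M + 1 : ℕ) : ℝ) ^ (-(z.re - 1)) := by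
          intro M
          rw [Complex.norm_cpow_eq_rpow_re_of_pos (by positivity)]
          push_cast
          simp
        simp_rw [this]
        exact (Filter.tendsto_add_atTop_iff_nat 1).2
          ((tendsto_rpow_neg_atTop (by linarith)).comp tendsto_natCast_atTop_atTop)
      have t4 := t2.add t3
      have := tendsto_nhds_unique (t1.congr (fun M => zb_partial z M)) t4
      rw [e1, e2, add_zero] at *
      exact this.symm)
  exact key hs

lemma tail_bound (M : ℕ) (K : ℕ) :
    ∑ n ∈ Finset.range K, (((n + M : ℕ) : ℝ) + 1) ^ (-(1/2:ℝ) - 1) ≤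
      6 * ((1 / √((M : ℝ) + 1)) - 1 / √((K + M : ℕ) + 1 : ℝ)) := by
  induction K with
  | zero => simp
  | succ K ih =>
    rw [Finset.sum_range_succ]
    set y : ℝ := ((K + M : ℕ) : ℝ) + 1 with hy
    have hy1 : 1 ≤ y := by rw [hy]; have : (0:ℝ) ≤ ((K+M : ℕ):ℝ) := Nat.cast_nonneg _; linarith
    have e : (((K + 1 + M : ℕ) : ℝ) + 1) = y + 1 := by rw [hy]; push_cast; ring
    rw [e]
    suffices y ^ (-(1/2:ℝ) - 1) ≤ 6 * (1 / √y - 1 / √(y+1)) by linarith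
    have h1 : y ^ (-(1/2:ℝ) - 1) = 1 / (y * √y) := by
      rw [show (-(1/2:ℝ) - 1) = -(1 + 1/2) by ring, Real.rpow_neg (by linarith),
        Real.rpow_add (by linarith), Real.rpow_one, Real.sqrt_eq_rpow, ← one_div]
    rw [h1]
    set a := √y
    set b := √(y+1)
    have ha : a ^ 2 = y := Real.sq_sqrt (by linarith)
    have hb : b ^ 2 = y + 1 := Real.sq_sqrt (by linarith)
    have ha1 : 1 ≤ a := Real.one_le_sqrt.2 hy1
    have hb0 : 0 ≤ b := Real.sqrt_nonneg _
    have hba : b ≤ 3/2 * a := by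
      nlinarith
    have hab : a < b := Real.sqrt_lt_sqrt (by linarith) (by linarith)
    rw [div_sub_div _ _ (by positivity) (by positivity), ← ha, mul_div_assoc', div_le_div_iff₀ (by positivity) (by positivity)]
    have : (b - a) * (b + a) = 1 := by nlinarith
    have h7 : 1 ≤ (b - a) * (5/2 * a) := by nlinarith
    have h8 : a * b * 1 ≤ a * (3/2*a) * ((b - a) * (5/2 * a)) := by gcongr
    have h9 : 0 ≤ a ^ 3 * (b - a) := mul_nonneg (by positivity) (by linarith)
    nlinarith

lemma zeta_approx (t : ℝ) (M : ℕ) :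
    ‖riemannZeta (1 / 2 + Complex.I * (t : ℂ)) -
      ∑ n ∈ Finset.range (M + 1), ((n + 1 : ℝ) : ℂ) ^ (-(1 / 2 + Complex.I * (t : ℂ)))‖ ≤
      √((M : ℝ) + 1) / (max (1/2) |t|) + 6 * (1 + |t|) / √((M : ℝ) + 1) := by
  set s : ℂ := 1 / 2 + Complex.I * (t : ℂ) with hs
  have hre : s.re = 1 / 2 := by simp [hs]
  have him : s.im = t := by simp [hs]
  have hs1 : s ≠ 1 := by intro h; rw [h] at hre; norm_num at hre
  have hsum := zb_summable s (by rw [hre]; norm_num)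
  have h1 := zeta1_eq s (by rw [hre]; norm_num)
  rw [← hsum.sum_add_tsum_nat_add M, ← add_assoc, zb_partial] at h1
  have h2 : riemannZeta s - ∑ n ∈ Finset.range (M + 1), ((n + 1 : ℝ) : ℂ) ^ (-s)
     = (s-1)⁻¹ * ((M + 1 : ℝ) : ℂ) ^ (1 - s) + (s-1)⁻¹ * ∑' n, zb (n + M) s := by
    rw [riemannZeta_eq_inv_sub_mul hs1, h1]
    have := sub_ne_zero.2 hs1
    field_simp
    ring
  rw [h2]
  have hlow : max (1/2) |t| ≤ ‖s - 1‖ := by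
    apply max_le
    · have := Complex.abs_re_le_norm (s - 1)
      rw [Complex.sub_re, hre] at this
      norm_num at this ⊢
      exact this
    · have := Complex.abs_im_le_norm (s - 1)
      simpa [him] using this
  have hpos : 0 < max (1/2) |t| := lt_of_lt_of_le (by norm_num) (le_max_left _ _)
  have hs' : ‖s‖ ≤ 1 + |t| := by
    have := Complex.norm_le_abs_re_add_abs_im s
    rw [hre, him] at this
    norm_num at this
    linarith
  refine (norm_add_le _ _).trans (add_le_add ?_ ?_)
  · rw [norm_mul, norm_inv, Complex.norm_cpow_eq_rpow_re_of_pos (by positivity), Complex.sub_re, hre,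
      inv_mul_eq_div, Real.sqrt_eq_rpow]
    norm_num
    gcongr
  · rw [norm_mul, norm_inv]
    have hb : ‖∑' n, zb (n + M) s‖ ≤ ‖s - 1‖ * ‖s‖ * (6 * (1 / √((M : ℝ) + 1))) := by
      have hsm : Summable (fun n => ‖zb (n + M) s‖) := ((summable_nat_add_iff M).2 hsum.norm)
      refine (norm_tsum_le_tsum_norm hsm).trans ?_
      apply hsm.tsum_le_of_sum_range_le
      intro K
      calc ∑ n ∈ Finset.range K, ‖zb (n + M) s‖ ≤ ∑ n ∈ Finset.range K,
            ‖s - 1‖ * ‖s‖ * (((n + M : ℕ) : ℝ) + 1) ^ (-(1/2:ℝ) - 1) := by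
            apply Finset.sum_le_sum
            intro n _
            have := zb_bound (n + M) s (by rw [hre]; norm_num)
            rwa [hre] at this
        _ ≤ _ := by
            rw [← Finset.mul_sum]
            gcongr
            refine (tail_bound M K).trans ?_
            have : 0 ≤ 1 / √((K + M : ℕ) + 1 : ℝ) := by positivity
            linarith
    have hn : 0 < ‖s - 1‖ := lt_of_lt_of_le hpos hlow
    calc ‖s - 1‖⁻¹ * ‖∑' n, zb (n + M) s‖ ≤ ‖s - 1‖⁻¹ * (‖s - 1‖ * ‖s‖ * (6 * (1 / √((M : ℝ) + 1)))) := by gcongr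
      _ = 6 * ‖s‖ / √((M : ℝ) + 1) := by field_simp
      _ ≤ _ := by gcongr

lemma zeta_growth (t : ℝ) : ‖riemannZeta (1 / 2 + Complex.I * (t : ℂ))‖ ≤ 9 * (1 + |t|) := by
  have h := zeta_approx t 0
  simp only [zero_add, Finset.sum_range_one, Nat.cast_zero, Complex.ofReal_one, Complex.one_cpow,
    Real.sqrt_one, div_one] at h
  have h1 : 1 / max (1/2) |t| ≤ 2 := by
    rw [div_le_iff₀ (lt_of_lt_of_le (by norm_num) (le_max_left _ _))]
    have := le_max_left (1/2) |t|
    linarith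
  have h2 := norm_le_norm_sub_add (riemannZeta (1 / 2 + Complex.I * (t : ℂ))) 1
  rw [norm_one] at h2
  have := abs_nonneg t
  linarith

lemma zeta_cont : Continuous (fun t : ℝ => riemannZeta (1 / 2 + Complex.I * (t : ℂ))) := by
  rw [continuous_iff_continuousAt]
  intro t
  have h1 : (1 / 2 + Complex.I * (t : ℂ)) ≠ 1 := by
    intro h
    have := congrArg Complex.re h
    norm_num at this
  exact ContinuousAt.comp (f := fun t : ℝ => (1 / 2 + Complex.I * (t : ℂ)))
    (differentiableAt_riemannZeta h1).continuousAt (by fun_prop)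

open FourierTransform in
lemma exists_kernel : ∃ K : ℝ → ℂ, Continuous K ∧ Integrable K ∧
    (∀ A : ℕ, ∃ C : ℝ, 0 < C ∧ ∀ v : ℝ, |v| ^ A * ‖K v‖ ≤ C * (1 + v ^ 2)⁻¹) ∧
    (∀ ξ : ℝ, |ξ| ≤ 1 → ∫ v, K v * Complex.exp (-(Complex.I * ξ * v)) = 1) := by
  let b : ContDiffBump (0 : ℝ) := ⟨1, 2, by norm_num, by norm_num⟩
  have hb1 : ContDiff ℝ (⊤ : ℕ∞) (fun x : ℝ => ((b x : ℝ) : ℂ)) :=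
    Complex.ofRealCLM.contDiff.comp b.contDiff
  have hb2 : HasCompactSupport (fun x : ℝ => ((b x : ℝ) : ℂ)) :=
    b.hasCompactSupport.comp_left (g := fun x : ℝ => (x : ℂ)) (by simp)
  let φ : SchwartzMap ℝ ℂ := hb2.toSchwartzMap hb1
  let K : SchwartzMap ℝ ℂ := 𝓕⁻ φ
  refine ⟨K, K.continuous, K.integrable, ?_, ?_⟩
  · intro A
    obtain ⟨C1, hC1, h1⟩ := K.decay A 0
    obtain ⟨C2, hC2, h2⟩ := K.decay (A + 2) 0
    refine ⟨C1 + C2, by positivity, fun v => ?_⟩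
    have h1 := h1 v
    have h2 := h2 v
    simp only [norm_iteratedFDeriv_zero, Real.norm_eq_abs] at h1 h2
    rw [← div_eq_mul_inv, le_div_iff₀ (by positivity)]
    rw [pow_add, sq_abs] at h2
    linarith
  · intro ξ hξ
    have h : (𝓕 K) (ξ / (2 * π)) = φ (ξ / (2 * π)) := by
      have : 𝓕 K = φ := FourierTransform.fourier_fourierInv_eq φ
      rw [this]
    rw [SchwartzMap.fourier_coe, Real.fourier_eq'] at h
    have hφ : φ (ξ / (2 * π)) = 1 := by
      change ((b (ξ / (2 * π)) : ℝ) : ℂ) = 1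
      rw [b.one_of_mem_closedBall]
      · simp
      · simp only [Metric.mem_closedBall, dist_zero_right, Real.norm_eq_abs]
        change |ξ / (2 * π)| ≤ 1
        rw [abs_div, abs_of_pos (by positivity : 0 < 2 * π), div_le_one (by positivity)]
        have := Real.pi_gt_three
        linarith
    rw [hφ] at h
    rw [← h]
    congr 1
    ext v
    rw [smul_eq_mul, mul_comm]
    congr 2
    simp only [RCLike.inner_apply, conj_trivial]
    push_cast
    have : (π : ℂ) ≠ 0 := by exact_mod_cast Real.pi_ne_zero
    field_simp

/-- Reproducing identity for powers of Dirichlet polynomials. -/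
lemma reproduce (K : ℝ → ℂ) (hKc : Continuous K) (hKi : Integrable K)
    (hK : ∀ ξ : ℝ, |ξ| ≤ 1 → ∫ v, K v * Complex.exp (-(Complex.I * ξ * v)) = 1)
    (M q : ℕ) (L t : ℝ) (hL0 : 0 < L) (hL : q * Real.log (M + 1) ≤ L) :
    ∫ v, K v * (∑ n ∈ Finset.range (M + 1),
        ((n + 1 : ℝ) : ℂ) ^ (-(1 / 2 + Complex.I * ((t + v / L : ℝ) : ℂ)))) ^ q =
      (∑ n ∈ Finset.range (M + 1), ((n + 1 : ℝ) : ℂ) ^ (-(1 / 2 + Complex.I * (t : ℂ)))) ^ q := by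
  have hterm : ∀ (n : ℕ) (x : ℝ), ((n + 1 : ℝ) : ℂ) ^ (-(1 / 2 + Complex.I * ((t + x : ℝ) : ℂ))) =
      ((n + 1 : ℝ) : ℂ) ^ (-(1 / 2 + Complex.I * (t : ℂ))) *
        Complex.exp (-(Complex.I * (Real.log (n + 1) : ℝ) * x)) := by
    intro n x
    have h0 : ((n + 1 : ℝ) : ℂ) ≠ 0 := by exact_mod_cast (by positivity : (0:ℝ) < n + 1).ne'
    rw [Complex.cpow_def_of_ne_zero h0, Complex.cpow_def_of_ne_zero h0, ← Complex.exp_add,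
      Complex.ofReal_log (by positivity)]
    congr 1
    push_cast
    ring
  simp_rw [Finset.sum_pow', hterm, Finset.prod_mul_distrib, ← Complex.exp_sum, Finset.mul_sum]
  have hexp : ∀ (p : Fin q → ℕ) (v : ℝ), (∑ i, -(Complex.I * ((Real.log ((p i : ℝ) + 1) : ℝ) : ℂ) * ((v / L : ℝ) : ℂ)))
      = -(Complex.I * (((∑ i, Real.log ((p i : ℝ) + 1)) / L : ℝ) : ℂ) * (v : ℂ)) := by
    intro p v
    push_cast
    rw [Finset.sum_neg_distrib, ← Finset.sum_mul, ← Finset.mul_sum]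
    ring
  simp_rw [hexp]
  rw [integral_finsetSum]
  · apply Finset.sum_congr rfl
    intro p hp
    have : ∀ v : ℝ, K v * ((∏ i, ((p i + 1 : ℝ) : ℂ) ^ (-(1 / 2 + Complex.I * (t : ℂ)))) *
        Complex.exp (-(Complex.I * (((∑ i, Real.log ((p i : ℝ) + 1)) / L : ℝ) : ℂ) * (v : ℂ)))) =
        (∏ i, ((p i + 1 : ℝ) : ℂ) ^ (-(1 / 2 + Complex.I * (t : ℂ)))) *
        (K v * Complex.exp (-(Complex.I * (((∑ i, Real.log ((p i : ℝ) + 1)) / L : ℝ) : ℂ) * (v : ℂ)))) := by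
      intro v; ring
    simp_rw [this]
    rw [integral_const_mul, hK, mul_one]
    have hnn : 0 ≤ ∑ i, Real.log ((p i : ℝ) + 1) :=
      Finset.sum_nonneg (fun i _ => Real.log_nonneg (by simp))
    rw [abs_of_nonneg (by positivity), div_le_one hL0]
    refine le_trans ?_ hL
    calc ∑ i, Real.log ((p i : ℝ) + 1) ≤ ∑ i : Fin q, Real.log ((M : ℝ) + 1) := by
          apply Finset.sum_le_sum
          intro i _
          have := (Fintype.mem_piFinset.1 hp) i
          rw [Finset.mem_range] at this
          apply Real.log_le_log (by positivity)
          have : p i ≤ M := by omega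
          have : (p i : ℝ) ≤ M := by exact_mod_cast this
          linarith
      _ = _ := by simp
  · intro p hp
    apply hKi.mul_bdd (c := ‖∏ i, ((p i + 1 : ℝ) : ℂ) ^ (-(1 / 2 + Complex.I * (t : ℂ)))‖)
    · apply Continuous.aestronglyMeasurable
      fun_prop
    · filter_upwards with v
      rw [norm_mul]
      have : ‖Complex.exp (-(Complex.I * (((∑ i, Real.log ((p i : ℝ) + 1)) / L : ℝ) : ℂ) * (v : ℂ)))‖ = 1 := by
        rw [Complex.norm_exp]; simp
      rw [this, mul_one]

noncomputable def zf (k : ℕ) (t : ℝ) : ℝ := ‖riemannZeta (1 / 2 + Complex.I * (t : ℂ))‖ ^ (2 * k)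

lemma zf_cont (k : ℕ) : Continuous (zf k) := by
  unfold zf
  exact zeta_cont.norm.pow _

lemma zf_nonneg (k : ℕ) (t : ℝ) : 0 ≤ zf k t := by unfold zf; positivity

lemma add_pow_le' (a b : ℝ) (ha : 0 ≤ a) (hb : 0 ≤ b) (n : ℕ) :
    (a + b) ^ n ≤ 2 ^ n * (a ^ n + b ^ n) := by
  refine (add_pow_le ha hb n).trans ?_
  gcongr
  · norm_num
  · omega

noncomputable def DP (M : ℕ) (t : ℝ) : ℂ :=
  ∑ n ∈ Finset.range (M + 1), ((n + 1 : ℝ) : ℂ) ^ (-(1 / 2 + Complex.I * (t : ℂ)))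

lemma DP_cont (M : ℕ) : Continuous (DP M) := by
  unfold DP
  refine continuous_finsetSum _ (fun n _ => ?_)
  have h0 : ((n + 1 : ℝ) : ℂ) ≠ 0 := by exact_mod_cast (by positivity : (0:ℝ) < n + 1).ne'
  exact Continuous.const_cpow (by fun_prop) (Or.inl h0)

lemma DP_le (M : ℕ) (t : ℝ) : ‖DP M t‖ ≤ M + 1 := by
  unfold DP
  refine (norm_sum_le _ _).trans ?_
  calc _ ≤ ∑ n ∈ Finset.range (M + 1), (1 : ℝ) := by
        apply Finset.sum_le_sum
        intro n _
        rw [Complex.norm_cpow_eq_rpow_re_of_pos (by positivity)]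
        apply Real.rpow_le_one_of_one_le_of_nonpos
        · have : (0:ℝ) ≤ n := Nat.cast_nonneg n
          linarith
        · simp
    _ = _ := by simp

lemma DP_approx (X : ℝ) (hX : 2 ≤ X) (M : ℕ) (h1 : X ^ 2 ≤ M + 1) (h2 : (M : ℝ) + 1 ≤ 2 * X ^ 2)
    (τ : ℝ) (hτ1 : X / 2 ≤ τ) (hτ2 : τ ≤ 3 * X) :
    ‖riemannZeta (1 / 2 + Complex.I * (τ : ℂ)) - DP M τ‖ ≤ 28 := by
  refine (zeta_approx τ M).trans ?_
  have hτ : |τ| = τ := abs_of_nonneg (by linarith)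
  have a1 : X ≤ √((M : ℝ) + 1) := Real.le_sqrt_of_sq_le h1
  have a2 : √((M : ℝ) + 1) ≤ 2 * X := by
    rw [Real.sqrt_le_left (by linarith)]
    nlinarith
  have a3 : X / 2 ≤ max (1/2) |τ| := le_max_of_le_right (by rw [hτ]; exact hτ1)
  have b1 : √((M : ℝ) + 1) / (max (1/2) |τ|) ≤ 4 := by
    rw [div_le_iff₀ (by linarith)]
    linarith
  have b2 : 6 * (1 + |τ|) / √((M : ℝ) + 1) ≤ 24 := by
    rw [div_le_iff₀ (by linarith), hτ]
    linarith
  linarith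

lemma pointwise (k : ℕ) (δ : ℝ) (hδ : 0 < δ) : ∃ C : ℝ, 0 < C ∧
    ∀ X G t : ℝ, 2 ≤ X → X ^ δ ≤ G → G ≤ X / 2 → X ≤ t → t ≤ 2 * X →
      zf k t ≤ C * X ^ δ * ((∫ u in (t - G)..(t + G), zf k u) + G) := by
  obtain ⟨K, hKc, hKi, hKd, hK1⟩ := exists_kernel
  obtain ⟨C0, hC0, hK0⟩ := hKd 0
  set A := ⌈4 * k / δ⌉₊ with hA
  obtain ⟨C1, hC1, hKA⟩ := hKd A
  set cL : ℝ := 6 * k / δ + 1 with hcL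
  have hcL1 : 1 ≤ cL := by rw [hcL]; have : 0 ≤ 6 * k / δ := by positivity
                           linarith
  set D : ℝ := 2 ^ (2 * k) with hD
  set E : ℝ := 28 ^ (2 * k) with hE
  have hD0 : 0 < D := by positivity
  have hE0 : 0 < E := by positivity
  refine ⟨D * (C0 * D * cL * (1 + 2 * E) + C1 * D * π + E), by positivity, ?_⟩
  intro X G t hX hG1 hG2 ht1 ht2
  have hXd : 1 ≤ X ^ δ := Real.one_le_rpow (by linarith) hδ.le
  have hG0 : 1 ≤ G := hXd.trans hG1
  set L := cL * X ^ δ with hLdef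
  have hL1 : 1 ≤ L := by nlinarith
  set M := ⌈X ^ 2⌉₊ with hM
  have hM1 : X ^ 2 ≤ M := Nat.le_ceil _
  have hM2 : (M : ℝ) < X ^ 2 + 1 := Nat.ceil_lt_add_one (by positivity)
  have hM3 : (M : ℝ) + 1 ≤ 2 * X ^ 2 := by nlinarith
  have hlog : ((2 * k : ℕ) : ℝ) * Real.log (M + 1) ≤ L := by
    have e1 : Real.log (M + 1) ≤ 3 * Real.log X := by
      have : (M : ℝ) + 1 ≤ X ^ 3 := by nlinarith
      calc Real.log (M + 1) ≤ Real.log (X ^ 3) := Real.log_le_log (by positivity) this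
        _ = _ := by rw [Real.log_pow]; norm_num
    have e2 := Real.log_le_rpow_div (x := X) (by linarith) hδ
    have : ((2 * k : ℕ) : ℝ) * Real.log (M + 1) ≤ ((2 * k : ℕ) : ℝ) * (3 * (X ^ δ / δ)) := by
      gcongr
      linarith
    refine this.trans ?_
    rw [hLdef, hcL]
    push_cast
    have : 2 * (k : ℝ) * (3 * (X ^ δ / δ)) = 6 * k / δ * X ^ δ := by ring
    rw [this]
    linarith
  have hrep : ∫ v, K v * (DP M (t + v / L)) ^ (2 * k) = (DP M t) ^ (2 * k) :=
    reproduce K hKc hKi hK1 M (2 * k) L t (by linarith) hlog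
  have hGA : X ^ (4 * k) ≤ G ^ A := by
    calc X ^ (4 * k) = X ^ ((4 * k : ℕ) : ℝ) := (Real.rpow_natCast _ _).symm
      _ ≤ X ^ (δ * A) := by
          apply Real.rpow_le_rpow_of_exponent_le (by linarith)
          have := Nat.le_ceil (4 * k / δ)
          rw [div_le_iff₀ hδ, ← hA] at this
          push_cast
          linarith
      _ = (X ^ δ) ^ A := by rw [Real.rpow_mul (by linarith), Real.rpow_natCast]
      _ ≤ G ^ A := by gcongr
  -- pointwise bound
  set g : ℝ → ℝ := fun v => (Set.Icc (-(L * G)) (L * G)).indicator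
    (fun v => C0 * (D * (zf k (t + v / L) + E))) v + C1 * D * (1 + v ^ 2)⁻¹ with hg
  have hpt : ∀ v, ‖K v * (DP M (t + v / L)) ^ (2 * k)‖ ≤ g v := by
    intro v
    rw [norm_mul, norm_pow]
    have hsq : 0 < 1 + v ^ 2 := by positivity
    by_cases hv : v ∈ Set.Icc (-(L * G)) (L * G)
    · simp only [hg, Set.indicator_of_mem hv]
      have k0 : ‖K v‖ ≤ C0 := by
        have := hK0 v
        rw [pow_zero, one_mul] at this
        refine this.trans ?_
        have : (1 + v ^ 2)⁻¹ ≤ 1 := inv_le_one_of_one_le₀ (by nlinarith)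
        nlinarith
      have hvL : -G ≤ v / L ∧ v / L ≤ G := by
        constructor
        · rw [le_div_iff₀ (by linarith)]; linarith [hv.1]
        · rw [div_le_iff₀ (by linarith)]; linarith [hv.2]
      have k1 := DP_approx X hX M (by linarith) hM3 (t + v / L) (by linarith) (by linarith)
      have k2 : ‖DP M (t + v / L)‖ ^ (2 * k) ≤ D * (zf k (t + v / L) + E) := by
        refine le_trans ?_ (add_pow_le' _ _ (norm_nonneg _) (by norm_num) _)
        gcongr
        have := norm_sub_norm_le (DP M (t + v / L)) (riemannZeta (1 / 2 + Complex.I * ((t + v / L : ℝ) : ℂ)))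
        rw [norm_sub_rev] at this
        linarith
      have : 0 ≤ C1 * D * (1 + v ^ 2)⁻¹ := by positivity
      have : ‖K v‖ * ‖DP M (t + v / L)‖ ^ (2 * k) ≤ C0 * (D * (zf k (t + v / L) + E)) := by gcongr
      linarith
    · simp only [hg, Set.indicator_of_notMem hv, zero_add]
      have hvG : G ≤ |v| := by
        rw [Set.mem_Icc, not_and_or, not_le, not_le] at hv
        have : G ≤ L * G := by nlinarith
        rcases hv with hv | hv
        · exact le_trans (by linarith) (neg_le_abs v)
        · exact le_trans (by linarith) (le_abs_self v)
      have k1 : X ^ (4 * k) * ‖K v‖ ≤ C1 * (1 + v ^ 2)⁻¹ := by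
        refine le_trans ?_ (hKA v)
        gcongr
        exact hGA.trans (by gcongr)
      have k2 : ‖DP M (t + v / L)‖ ^ (2 * k) ≤ D * X ^ (4 * k) := by
        calc ‖DP M (t + v / L)‖ ^ (2 * k) ≤ (2 * X ^ 2) ^ (2 * k) := by
              gcongr
              exact (DP_le _ _).trans hM3
          _ = _ := by rw [mul_pow, ← pow_mul, hD]; ring_nf
      calc ‖K v‖ * ‖DP M (t + v / L)‖ ^ (2 * k) ≤ ‖K v‖ * (D * X ^ (4 * k)) := by gcongr
        _ = D * (X ^ (4 * k) * ‖K v‖) := by ring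
        _ ≤ D * (C1 * (1 + v ^ 2)⁻¹) := by gcongr
        _ = _ := by ring
  have hcf : Continuous (fun v => C0 * (D * (zf k (t + v / L) + E))) := by
    have := zf_cont k
    fun_prop
  have hi1 : Integrable ((Set.Icc (-(L * G)) (L * G)).indicator
    (fun v => C0 * (D * (zf k (t + v / L) + E)))) :=
    (integrable_indicator_iff measurableSet_Icc).2 (hcf.continuousOn.integrableOn_Icc)
  have hi2 : Integrable (fun v : ℝ => C1 * D * (1 + v ^ 2)⁻¹) := integrable_inv_one_add_sq.const_mul _
  have hint : ∫ v, g v = C0 * D * L * (∫ u in (t - G)..(t + G), zf k u) + C0 * D * E * (2 * L * G) + C1 * D * π := by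
    rw [hg, integral_add hi1 hi2, integral_const_mul, integral_univ_inv_one_add_sq,
      integral_indicator measurableSet_Icc, integral_Icc_eq_integral_Ioc,
      ← intervalIntegral.integral_of_le (by nlinarith), intervalIntegral.integral_const_mul,
      intervalIntegral.integral_const_mul, intervalIntegral.integral_add,
      intervalIntegral.integral_comp_add_div (fun u => zf k u) (by linarith),
      intervalIntegral.integral_const]
    · have e1 : t + -(L * G) / L = t - G := by field_simp; ring
      have e2 : t + L * G / L = t + G := by field_simp
      rw [e1, e2]
      simp only [smul_eq_mul]
      ring
    · apply Continuous.intervalIntegrable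
      have := zf_cont k
      fun_prop
    · simp
  have hDP : ‖DP M t‖ ^ (2 * k) ≤ ∫ v, g v := by
    rw [← norm_pow, ← hrep]
    exact norm_integral_le_of_norm_le (hi1.add hi2) (Filter.Eventually.of_forall hpt)
  rw [hint] at hDP
  have hz : zf k t ≤ D * (‖DP M t‖ ^ (2 * k) + E) := by
    refine le_trans ?_ (add_pow_le' _ _ (norm_nonneg _) (by norm_num) _)
    unfold zf
    gcongr
    have k1 := DP_approx X hX M (by linarith) hM3 t (by linarith) (by linarith)
    have := norm_sub_norm_le (riemannZeta (1 / 2 + Complex.I * (t : ℂ))) (DP M t)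
    linarith
  set S := ∫ u in (t - G)..(t + G), zf k u
  have hS : 0 ≤ S := intervalIntegral.integral_nonneg (by linarith) (fun u _ => zf_nonneg k u)
  have hone : 1 ≤ X ^ δ * (S + G) := by nlinarith
  refine hz.trans ?_
  rw [mul_assoc, mul_assoc]
  refine mul_le_mul_of_nonneg_left ?_ hD0.le
  set W := X ^ δ * (S + G) with hW
  have f1 : C0 * D * L * S + C0 * D * E * (2 * L * G) ≤ C0 * D * cL * (1 + 2 * E) * W := by
    have : C0 * D * cL * (1 + 2 * E) * W - (C0 * D * L * S + C0 * D * E * (2 * L * G)) =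
      C0 * D * cL * X ^ δ * (G + 2 * E * S) := by rw [hW, hLdef]; ring
    have : 0 ≤ C0 * D * cL * X ^ δ * (G + 2 * E * S) := by positivity
    linarith
  have f2 : C1 * D * π * 1 ≤ C1 * D * π * W := by gcongr
  have f3 : E * 1 ≤ E * W := by gcongr
  linarith

lemma J_eq (k : ℕ) (t G : ℝ) : J k t G = (1 / (√π * G)) *
    ∫ u : ℝ, zf k (t + u) * Real.exp (-(u / G) ^ 2) := by
  unfold J zf
  congr 3
  ext u
  push_cast
  rw [mul_add, ← add_assoc]

lemma zf_growth (k : ℕ) (R t u : ℝ) (hR : 0 ≤ R) (ht : |t| ≤ R) :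
    zf k (t + u) ≤ 9 ^ (2 * k) * (2 ^ (2 * k) * ((1 + R) ^ (2 * k) + u ^ (2 * k))) := by
  have h1 : zf k (t + u) ≤ (9 * (1 + |t + u|)) ^ (2 * k) := by
    unfold zf
    gcongr
    exact zeta_growth _
  refine h1.trans ?_
  rw [mul_pow]
  gcongr
  have h2 : u ^ (2 * k) = |u| ^ (2 * k) := by rw [pow_mul, pow_mul, sq_abs]
  rw [h2]
  refine le_trans ?_ (add_pow_le' _ _ (by linarith) (abs_nonneg u) _)
  refine pow_le_pow_left₀ (by positivity) ?_ _
  have := abs_add_le t u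
  linarith

lemma bound_integrable (k : ℕ) (R G : ℝ) (hG : 0 < G) : Integrable (fun u : ℝ =>
    9 ^ (2 * k) * (2 ^ (2 * k) * ((1 + R) ^ (2 * k) + u ^ (2 * k))) * Real.exp (-(u / G) ^ 2)) := by
  have hb : 0 < 1 / G ^ 2 := by positivity
  have e : ∀ u : ℝ, -(u / G) ^ 2 = -(1 / G ^ 2) * u ^ 2 := by intro u; field_simp
  have h1 := integrable_exp_neg_mul_sq hb
  have h2 := integrable_rpow_mul_exp_neg_mul_sq hb (s := ((2 * k : ℕ) : ℝ)) (by
    have : (0:ℝ) ≤ ((2 * k : ℕ) : ℝ) := Nat.cast_nonneg _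
    linarith)
  simp_rw [Real.rpow_natCast] at h2
  have h3 := (h1.const_mul (9 ^ (2 * k) * (2 ^ (2 * k) * ((1 + R) ^ (2 * k))))).add
    (h2.const_mul (9 ^ (2 * k) * (2 ^ (2 * k))))
  refine h3.congr (Filter.Eventually.of_forall (fun u => ?_))
  simp only [Pi.add_apply, e]
  ring

lemma J_integrable (k : ℕ) (t G : ℝ) (hG : 0 < G) :
    Integrable (fun u : ℝ => zf k (t + u) * Real.exp (-(u / G) ^ 2)) := by
  refine (bound_integrable k |t| G hG).mono' ?_ ?_
  · apply Continuous.aestronglyMeasurable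
    have := zf_cont k
    fun_prop
  · filter_upwards with u
    rw [Real.norm_eq_abs, abs_of_nonneg (mul_nonneg (zf_nonneg _ _) (Real.exp_nonneg _))]
    gcongr
    exact zf_growth k |t| t u (abs_nonneg _) le_rfl

lemma J_cont (k : ℕ) (G : ℝ) (hG : 0 < G) : Continuous (fun t => J k t G) := by
  simp_rw [J_eq]
  apply Continuous.mul continuous_const
  rw [continuous_iff_continuousAt]
  intro t
  have hz := zf_cont k
  refine continuousAt_of_dominated (bound := fun u : ℝ =>
    9 ^ (2 * k) * (2 ^ (2 * k) * ((1 + (|t| + 1)) ^ (2 * k) + u ^ (2 * k))) * Real.exp (-(u / G) ^ 2))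
    ?_ ?_ (bound_integrable k (|t| + 1) G hG) ?_
  · filter_upwards with x
    apply Continuous.aestronglyMeasurable
    fun_prop
  · filter_upwards [Metric.ball_mem_nhds t one_pos] with x hx
    filter_upwards with u
    rw [Real.norm_eq_abs, abs_of_nonneg (mul_nonneg (zf_nonneg _ _) (Real.exp_nonneg _))]
    gcongr
    refine zf_growth k (|t| + 1) x u (by positivity) ?_
    rw [Metric.mem_ball, Real.dist_eq] at hx
    have := abs_sub_abs_le_abs_sub x t
    linarith
  · filter_upwards with u
    apply Continuous.continuousAt
    fun_prop

lemma J_nonneg (k : ℕ) (t G : ℝ) (hG : 0 < G) : 0 ≤ J k t G := by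
  rw [J_eq]
  exact mul_nonneg (by positivity)
    (integral_nonneg (fun u => mul_nonneg (zf_nonneg _ _) (Real.exp_nonneg _)))

lemma J_lower (k : ℕ) (s G a b : ℝ) (hG : 0 < G) (hab : a ≤ b) (ha : s - 3 * G ≤ a)
    (hb : b ≤ s + 3 * G) :
    ∫ u in a..b, zf k u ≤ (Real.exp 9 * √π) * G * J k s G := by
  have hpi : 0 < √π := Real.sqrt_pos.2 Real.pi_pos
  have e1 : (Real.exp 9 * √π) * G * J k s G =
      Real.exp 9 * ∫ u : ℝ, zf k (s + u) * Real.exp (-(u / G) ^ 2) := by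
    rw [J_eq]; field_simp
  have e2 : ∫ u in a..b, zf k u = ∫ u in (a - s)..(b - s), zf k (s + u) := by
    rw [intervalIntegral.integral_comp_add_left (fun u => zf k u)]
    congr 1 <;> ring
  rw [e1, e2]
  have hz := zf_cont k
  have h1 : ∫ u in (a - s)..(b - s), zf k (s + u) ≤
      ∫ u in (a - s)..(b - s), Real.exp 9 * (zf k (s + u) * Real.exp (-(u / G) ^ 2)) := by
    apply intervalIntegral.integral_mono_on (by linarith)
    · apply Continuous.intervalIntegrable; fun_prop
    · apply Continuous.intervalIntegrable; fun_prop
    · intro u hu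
      have hu1 : -3 ≤ u / G := by rw [le_div_iff₀ hG]; linarith [hu.1]
      have hu2 : u / G ≤ 3 := by rw [div_le_iff₀ hG]; linarith [hu.2]
      have h3 : 1 ≤ Real.exp 9 * Real.exp (-(u / G) ^ 2) := by
        rw [← Real.exp_add]
        apply Real.one_le_exp
        nlinarith
      have := zf_nonneg k (s + u)
      nlinarith
  refine h1.trans ?_
  rw [intervalIntegral.integral_const_mul, intervalIntegral.integral_of_le (by linarith)]
  refine mul_le_mul_of_nonneg_left ?_ (Real.exp_nonneg _)
  exact setIntegral_le_integral (J_integrable k s G hG)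
    (Filter.Eventually.of_forall (fun u => mul_nonneg (zf_nonneg _ _) (Real.exp_nonneg _)))

lemma block (k m : ℕ) (C V X G a h : ℝ) (hC : 0 < C) (hV : 0 ≤ V) (hG : 0 < G)
    (hp : ∀ t, X ≤ t → t ≤ 2 * X → zf k t ≤ C * V * ((∫ u in (t - G)..(t + G), zf k u) + G))
    (ha : X ≤ a) (hb : a + h ≤ 2 * X) (h1 : G ≤ h) (h2 : h ≤ 2 * G) :
    ∫ t in a..(a + h), zf k t ^ (m + 1) ≤
      ((C * V) ^ m * (Real.exp 9 * √π + 1) ^ (m + 1) * G ^ m) *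
        ∫ s in a..(a + h), (J k s G + 1) ^ (m + 1) := by
  have hz := zf_cont k
  have hJ := J_cont k G hG
  set E := Real.exp 9 * √π with hE
  have hE0 : 0 ≤ E := by positivity
  have key : ∀ s ∈ Set.Icc a (a + h), ∫ t in a..(a + h), zf k t ^ (m + 1) ≤
      ((C * V) ^ m * (E + 1) ^ (m + 1) * G ^ (m + 1)) * (J k s G + 1) ^ (m + 1) := by
    intro s hs
    have hJ0 := J_nonneg k s G hG
    have hq : ∀ t ∈ Set.Icc a (a + h), zf k t ≤ C * V * ((E + 1) * G * (J k s G + 1)) := by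
      intro t ht
      refine (hp t (ha.trans ht.1) (ht.2.trans hb)).trans ?_
      have := J_lower k s G (t - G) (t + G) hG (by linarith) (by linarith [hs.2, ht.1])
        (by linarith [hs.1, ht.2])
      rw [← hE] at this
      gcongr
      have : 0 ≤ E * G + G * J k s G := by positivity
      nlinarith
    have hI := J_lower k s G a (a + h) hG (by linarith) (by linarith [hs.2])
        (by linarith [hs.1])
    rw [← hE] at hI
    calc ∫ t in a..(a + h), zf k t ^ (m + 1)
        ≤ ∫ t in a..(a + h), (C * V * ((E + 1) * G * (J k s G + 1))) ^ m * zf k t := by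
          apply intervalIntegral.integral_mono_on (by linarith)
          · apply Continuous.intervalIntegrable; fun_prop
          · apply Continuous.intervalIntegrable; fun_prop
          · intro t ht
            rw [pow_succ]
            have := zf_nonneg k t
            gcongr
            exact hq t ht
      _ = (C * V * ((E + 1) * G * (J k s G + 1))) ^ m * ∫ t in a..(a + h), zf k t := by
          rw [intervalIntegral.integral_const_mul]
      _ ≤ (C * V * ((E + 1) * G * (J k s G + 1))) ^ m * ((E + 1) * G * (J k s G + 1)) := by
          gcongr
          have : 0 ≤ E * G + G * J k s G := by positivity
          nlinarith
      _ = _ := by rw [mul_pow, mul_pow, mul_pow ((E + 1) * G), mul_pow (E + 1)]; ring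
  have hmono := intervalIntegral.integral_mono_on (μ := volume) (a := a) (b := a + h) (by linarith)
    (f := fun _ => ∫ t in a..(a + h), zf k t ^ (m + 1))
    (g := fun s => ((C * V) ^ m * (E + 1) ^ (m + 1) * G ^ (m + 1)) * (J k s G + 1) ^ (m + 1))
    (by simp) (by apply Continuous.intervalIntegrable; fun_prop) key
  rw [intervalIntegral.integral_const, intervalIntegral.integral_const_mul, smul_eq_mul] at hmono
  have hI0 : 0 ≤ ∫ t in a..(a + h), zf k t ^ (m + 1) :=
    intervalIntegral.integral_nonneg (by linarith) (fun t _ => pow_nonneg (zf_nonneg k t) _)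
  refine le_of_mul_le_mul_left ?_ hG
  calc G * ∫ t in a..(a + h), zf k t ^ (m + 1)
      ≤ (a + h - a) * ∫ t in a..(a + h), zf k t ^ (m + 1) := by gcongr; linarith
    _ ≤ _ := hmono
    _ = _ := by ring

lemma blocks (k m : ℕ) (C V X G : ℝ) (hC : 0 < C) (hV : 0 ≤ V) (hG : 0 < G) (hGX : G ≤ X)
    (hp : ∀ t, X ≤ t → t ≤ 2 * X → zf k t ≤ C * V * ((∫ u in (t - G)..(t + G), zf k u) + G)) :
    ∫ t in X..(2 * X), zf k t ^ (m + 1) ≤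
      ((C * V) ^ m * (Real.exp 9 * √π + 1) ^ (m + 1) * G ^ m) *
        ∫ s in X..(2 * X), (J k s G + 1) ^ (m + 1) := by
  have hz := zf_cont k
  have hJ := J_cont k G hG
  set n := ⌊X / G⌋₊ with hn
  have hn1 : 1 ≤ n := Nat.le_floor (by rw [Nat.cast_one, le_div_iff₀ hG]; linarith)
  have hn1' : (1 : ℝ) ≤ n := by exact_mod_cast hn1
  have hn2 : (n : ℝ) ≤ X / G := Nat.floor_le (by apply div_nonneg <;> linarith)
  have hn3 : X / G < n + 1 := Nat.lt_floor_add_one _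
  rw [le_div_iff₀ hG] at hn2
  rw [div_lt_iff₀ hG] at hn3
  set h := X / n with hh
  have hnh : n * h = X := by rw [hh]; field_simp
  have h1 : G ≤ h := by rw [hh, le_div_iff₀ (by linarith)]; linarith
  have h2 : h ≤ 2 * G := by rw [hh, div_le_iff₀ (by linarith)]; nlinarith
  have s1 := intervalIntegral.sum_integral_adjacent_intervals (μ := volume)
    (f := fun t => zf k t ^ (m + 1))
    (a := fun i : ℕ => X + i * h) (n := n) (fun i _ => by
      apply Continuous.intervalIntegrable; fun_prop)
  have s2 := intervalIntegral.sum_integral_adjacent_intervals (μ := volume)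
    (f := fun s => (J k s G + 1) ^ (m + 1))
    (a := fun i : ℕ => X + i * h) (n := n) (fun i _ => by
      apply Continuous.intervalIntegrable; fun_prop)
  have e0 : X + ((0 : ℕ) : ℝ) * h = X := by simp
  have en : X + (n : ℝ) * h = 2 * X := by rw [hnh]; ring
  simp only [e0, en] at s1 s2
  rw [← s1, ← s2, Finset.mul_sum]
  apply Finset.sum_le_sum
  intro i hi
  rw [Finset.mem_range] at hi
  have hi' : (i : ℝ) + 1 ≤ n := by exact_mod_cast hi
  have e : X + ((i + 1 : ℕ) : ℝ) * h = (X + i * h) + h := by push_cast; ring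
  rw [e]
  have hi0 : (0 : ℝ) ≤ i := Nat.cast_nonneg i
  apply block k m C V X G (X + i * h) h hC hV hG hp
  · have : 0 ≤ i * h := by apply mul_nonneg <;> linarith
    linarith
  · have : (i + 1) * h ≤ n * h := by gcongr; linarith
    linarith
  · exact h1
  · exact h2

lemma dyadic (k m : ℕ) (α : ℝ) (hα0 : 0 ≤ α) (hα1 : α < 1)
    (H : ∀ ε : ℝ, 0 < ε → ∃ C : ℝ, 0 < C ∧
      ∀ T G : ℝ, 2 ≤ T → T ^ (α + ε) ≤ G → G ≤ T →
        (∫ t in T..(2 * T), J k t G ^ (m + 1)) ≤ C * T ^ (1 + ε)) (ε : ℝ) (hε : 0 < ε) :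
    ∃ C X0 : ℝ, 0 < C ∧ 2 ≤ X0 ∧ ∀ X : ℝ, X0 ≤ X →
      ∫ t in X..(2 * X), zf k t ^ (m + 1) ≤ C * X ^ (1 + m * α + ε) := by
  set δ := min (ε / (2 * m + 1)) ((1 - α) / 2) with hδdef
  have hδ : 0 < δ := lt_min (by positivity) (by linarith)
  have hδ1 : (2 * m + 1) * δ ≤ ε := by
    have : δ ≤ ε / (2 * m + 1) := min_le_left _ _
    rw [le_div_iff₀ (by positivity)] at this
    linarith
  have hδ2 : δ ≤ (1 - α) / 2 := min_le_right _ _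
  obtain ⟨C, hC, hp⟩ := pointwise k δ hδ
  obtain ⟨CH, hCH, hH⟩ := H δ hδ
  refine ⟨(C ^ m * (Real.exp 9 * √π + 1) ^ (m + 1)) * (2 ^ (m + 1) * (CH + 1)),
    max 2 ((2 : ℝ) ^ (2 / (1 - α))), by positivity, le_max_left _ _, ?_⟩
  intro X hX
  have hX2 : 2 ≤ X := (le_max_left _ _).trans hX
  have hXp : (2 : ℝ) ^ (2 / (1 - α)) ≤ X := (le_max_right _ _).trans hX
  have hX0 : 0 < X := by linarith
  have hhalf : 2 ≤ X ^ ((1 - α) / 2) := by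
    calc (2 : ℝ) = ((2 : ℝ) ^ (2 / (1 - α))) ^ ((1 - α) / 2) := by
          rw [← Real.rpow_mul (by norm_num)]
          have : 2 / (1 - α) * ((1 - α) / 2) = 1 := by
            have : 1 - α ≠ 0 := by linarith
            field_simp
          rw [this, Real.rpow_one]
      _ ≤ _ := Real.rpow_le_rpow (by positivity) hXp (by linarith)
  set G := X ^ (α + δ) with hGdef
  have hG0 : 0 < G := by positivity
  have hG1 : X ^ δ ≤ G := Real.rpow_le_rpow_of_exponent_le (by linarith) (by linarith)
  have hG2 : G ≤ X / 2 := by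
    have e : G * X ^ ((1 - α) / 2) ≤ X := by
      rw [hGdef, ← Real.rpow_add hX0]
      calc _ ≤ X ^ (1 : ℝ) := Real.rpow_le_rpow_of_exponent_le (by linarith) (by linarith)
        _ = X := Real.rpow_one X
    nlinarith
  have hb := blocks k m C (X ^ δ) X G hC (by positivity) hG0 (by linarith)
    (fun t h1 h2 => hp X G t hX2 hG1 hG2 h1 h2)
  have hJ := J_cont k G hG0
  have hJ1 : ∫ s in X..(2 * X), (J k s G + 1) ^ (m + 1) ≤ 2 ^ (m + 1) * ((CH + 1) * X ^ (1 + δ)) := by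
    calc ∫ s in X..(2 * X), (J k s G + 1) ^ (m + 1)
        ≤ ∫ s in X..(2 * X), 2 ^ (m + 1) * (J k s G ^ (m + 1) + 1) := by
          apply intervalIntegral.integral_mono_on (by linarith)
          · apply Continuous.intervalIntegrable; fun_prop
          · apply Continuous.intervalIntegrable; fun_prop
          · intro s _
            have := add_pow_le' (J k s G) 1 (J_nonneg k s G hG0) (by norm_num) (m + 1)
            rwa [one_pow] at this
      _ = 2 ^ (m + 1) * ((∫ s in X..(2 * X), J k s G ^ (m + 1)) + X) := by
          rw [intervalIntegral.integral_const_mul, intervalIntegral.integral_add,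
            intervalIntegral.integral_const]
          · simp only [smul_eq_mul]; ring
          · apply Continuous.intervalIntegrable; fun_prop
          · simp
      _ ≤ _ := by
          gcongr
          have e1 := hH X G hX2 le_rfl (by linarith)
          have e2 : X ≤ X ^ (1 + δ) := by
            calc X = X ^ (1 : ℝ) := (Real.rpow_one X).symm
              _ ≤ _ := Real.rpow_le_rpow_of_exponent_le (by linarith) (by linarith)
          linarith
  have hexp : (X ^ δ) ^ m * G ^ m * X ^ (1 + δ) ≤ X ^ (1 + m * α + ε) := by
    rw [hGdef, ← Real.rpow_natCast (X ^ δ), ← Real.rpow_natCast (X ^ (α + δ)), ← Real.rpow_mul hX0.le,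
      ← Real.rpow_mul hX0.le, ← Real.rpow_add hX0, ← Real.rpow_add hX0]
    apply Real.rpow_le_rpow_of_exponent_le (by linarith)
    nlinarith
  calc _ ≤ _ := hb
    _ ≤ ((C * X ^ δ) ^ m * (Real.exp 9 * √π + 1) ^ (m + 1) * G ^ m) *
        (2 ^ (m + 1) * ((CH + 1) * X ^ (1 + δ))) := by gcongr
    _ = (C ^ m * (Real.exp 9 * √π + 1) ^ (m + 1)) * (2 ^ (m + 1) * (CH + 1)) *
        ((X ^ δ) ^ m * G ^ m * X ^ (1 + δ)) := by rw [mul_pow]; ring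
    _ ≤ _ := by gcongr

lemma sum_dyadic (f : ℝ → ℝ) (hf : Continuous f) (h0 : ∀ t, 0 ≤ f t) (C X0 β : ℝ) (hC : 0 < C)
    (hX0 : 2 ≤ X0) (hβ : 1 ≤ β)
    (h : ∀ X, X0 ≤ X → ∫ t in X..(2 * X), f t ≤ C * X ^ β) :
    ∃ C' : ℝ, 0 < C' ∧ ∀ T : ℝ, 2 ≤ T → ∫ t in (0:ℝ)..T, f t ≤ C' * T ^ β := by
  have hii : ∀ a b, IntervalIntegrable f volume a b := fun a b => hf.intervalIntegrable a b
  set B := ∫ t in (0:ℝ)..(2 * X0), f t with hB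
  have hB0 : 0 ≤ B := intervalIntegral.integral_nonneg (by linarith) (fun t _ => h0 t)
  have base : ∀ T, 2 ≤ T → T ≤ 2 * X0 → ∫ t in (0:ℝ)..T, f t ≤ (B + C) * T ^ β := by
    intro T hT1 hT2
    have e1 : ∫ t in (0:ℝ)..T, f t ≤ B := by
      rw [hB, ← intervalIntegral.integral_add_adjacent_intervals (hii 0 T) (hii T (2 * X0))]
      have := intervalIntegral.integral_nonneg (μ := volume) hT2 (fun t _ => h0 t)
      linarith
    have e2 : 1 ≤ T ^ β := Real.one_le_rpow (by linarith) (by linarith)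
    nlinarith
  have main : ∀ n : ℕ, ∀ T, 2 ≤ T → T ≤ 2 ^ n * (2 * X0) → ∫ t in (0:ℝ)..T, f t ≤ (B + C) * T ^ β := by
    intro n
    induction n with
    | zero => intro T h1 h2; exact base T h1 (by simpa using h2)
    | succ n ih =>
      intro T h1 h2
      by_cases hT : T ≤ 2 * X0
      · exact base T h1 hT
      · push Not at hT
        have i1 := ih (T / 2) (by linarith) (by rw [pow_succ] at h2; linarith)
        have i2 := h (T / 2) (by linarith)
        rw [show 2 * (T / 2) = T by ring] at i2
        rw [← intervalIntegral.integral_add_adjacent_intervals (hii 0 (T / 2)) (hii (T / 2) T)]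
        have e : 2 * (T / 2) ^ β ≤ T ^ β := by
          rw [Real.div_rpow (by linarith) (by norm_num)]
          have h2b : (2 : ℝ) ≤ 2 ^ β := by
            calc (2 : ℝ) = 2 ^ (1 : ℝ) := (Real.rpow_one 2).symm
              _ ≤ _ := Real.rpow_le_rpow_of_exponent_le (by norm_num) hβ
          have : 0 ≤ T ^ β := by positivity
          rw [mul_div_assoc', div_le_iff₀ (by positivity)]
          nlinarith
        have p : 0 ≤ (T / 2) ^ β := by positivity
        nlinarith
  refine ⟨B + C, by linarith, fun T hT => ?_⟩
  obtain ⟨n, hn⟩ := pow_unbounded_of_one_lt T (by norm_num : (1:ℝ) < 2)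
  refine main n T hT ?_
  have : (0:ℝ) < 2 ^ n := by positivity
  nlinarith


/-- If `∫_T^{2T} J_k(t,G)^m dt ≪_ε T^{1+ε}` uniformly for `T^{α+ε} ≤ G ≤ T`, where
`0 ≤ α < 1`, then `∫_0^T |ζ(1/2+it)|^{2km} dt ≪_ε T^{1+(m-1)α+ε}`. -/
theorem zeta_moment_of_J_moment (k m : ℕ) (hk : 0 < k) (hm : 0 < m)
    (α : ℝ) (hα0 : 0 ≤ α) (hα1 : α < 1)
    (H : ∀ ε : ℝ, 0 < ε → ∃ C : ℝ, 0 < C ∧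
      ∀ T G : ℝ, 2 ≤ T → T ^ (α + ε) ≤ G → G ≤ T →
        (∫ t in T..(2 * T), J k t G ^ m) ≤ C * T ^ (1 + ε)) :
    ∀ ε : ℝ, 0 < ε → ∃ C : ℝ, 0 < C ∧ ∀ T : ℝ, 2 ≤ T →
      (∫ t in (0:ℝ)..T, ‖riemannZeta (1 / 2 + Complex.I * (t : ℂ))‖ ^ (2 * k * m)) ≤
        C * T ^ (1 + (m - 1 : ℝ) * α + ε) := by
  obtain ⟨m, rfl⟩ : ∃ m', m = m' + 1 := ⟨m - 1, by omega⟩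
  intro ε hε
  obtain ⟨C, X0, hC, hX0, h⟩ := dyadic k m α hα0 hα1 H ε hε
  have hm0 : (0 : ℝ) ≤ m * α := by positivity
  obtain ⟨C', hC', h'⟩ := sum_dyadic (fun t => zf k t ^ (m + 1)) ((zf_cont k).pow _)
    (fun t => pow_nonneg (zf_nonneg k t) _) C X0 (1 + m * α + ε) hC hX0 (by linarith) h
  refine ⟨C', hC', fun T hT => ?_⟩
  have h1 := h' T hT
  have e : (((m + 1 : ℕ) : ℝ) - 1) = m := by push_cast; ring
  rw [e]
  simpa only [zf, ← pow_mul] using h1
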